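/- Let κ be an element of the root lattice ℤR such that: (i) ⟨κ,α∨⟩ ≤ 2 for all roots α, and whenever ⟨κ,α∨⟩ = 2 the coroot α∨ is a highest coroot; and (ii) κ is dominant. Then κ is a multiplicity-free sum of roots whose corresponding coroots are highest coroots; i.e. κ = Σ_{i∈S} α_i for pairwise distinct roots α_i such that each α_i∨ is a highest coroot. -/

import Mathlib

open scoped Classical Pointwise

namespace SerrePaper

variable (V : Type) [AddCommGroup V] [Module ℝ V]

/-- The combinatorial context of the paper: the character lattice `X` of a split maximal
torus, sitting inside the real vector space `V = X ⊗ ℝ`, together with a reduced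
crystallographic root system `R` with positive roots `Rpos`, simple roots `Δ`,
the coroot pairing `coroot α = ⟨·, α∨⟩`, the weight `η` pairing to `1` with every simple
coroot, and the longest element `w0` of the Weyl group. -/
structure Ctx where
  R : Finset V
  Rpos : Finset V
  Δ : Finset V
  coroot : V → V →ₗ[ℝ] ℝ
  eta : V
  w0 : V ≃ₗ[ℝ] V
  X : AddSubgroup V
  pos_subset : Rpos ⊆ R
  simple_subset : Δ ⊆ Rpos
  root_ne_zero : ∀ α ∈ R, α ≠ (0 : V)
  neg_mem : ∀ α ∈ R, -α ∈ R
  pos_or_neg : ∀ α ∈ R, α ∈ Rpos ∨ -α ∈ Rpos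
  pos_not_neg : ∀ α ∈ Rpos, -α ∉ Rpos
  coroot_self : ∀ α ∈ R, coroot α α = 2
  coroot_neg : ∀ α ∈ R, coroot (-α) = -coroot α
  crystallographic : ∀ α ∈ R, ∀ β ∈ R, ∃ n : ℤ, coroot α β = (n : ℝ)
  reduced : ∀ α ∈ R, ∀ c : ℝ, c • α ∈ R → c = 1 ∨ c = -1
  reflect_root : ∀ α ∈ R, ∀ β ∈ R, β - coroot α β • α ∈ R
  reflect_coroot : ∀ α ∈ R, ∀ β ∈ R, ∀ x : V,
    coroot (β - coroot α β • α) x = coroot β x - coroot β α * coroot α x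
  pos_sum_simple : ∀ α ∈ Rpos, ∃ c : V → ℕ, α = ∑ β ∈ Δ, (c β : ℝ) • β
  simple_indep : LinearIndependent ℝ (fun β : {x // x ∈ Δ} => (β : V))
  eta_pair : ∀ α ∈ Δ, coroot α eta = 1
  root_mem_X : ∀ α ∈ R, α ∈ X
  eta_mem_X : eta ∈ X
  coroot_int : ∀ α ∈ R, ∀ x ∈ X, ∃ n : ℤ, coroot α x = (n : ℝ)
  w0_mem : w0 ∈ Subgroup.closure {g : V ≃ₗ[ℝ] V | ∃ α ∈ R, ∀ x, g x = x - coroot α x • α}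
  w0_neg : ∀ α ∈ Rpos, -(w0 α) ∈ Rpos

namespace Ctx

variable {V}
variable (S : Ctx V)

/-- The (finite) Weyl group, generated by the reflections `s_α`, `α ∈ R`. -/
def Weyl : Subgroup (V ≃ₗ[ℝ] V) :=
  Subgroup.closure {g : V ≃ₗ[ℝ] V | ∃ α ∈ S.R, ∀ x, g x = x - S.coroot α x • α}

/-- The translation `t_ν` as an affine automorphism of `V`. -/
def trans (_S : Ctx V) (ν : V) : V ≃ᵃ[ℝ] V := AffineEquiv.constVAdd ℝ V ν

/-- A linear automorphism viewed as an affine automorphism. -/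
def ofW (_S : Ctx V) (w : V ≃ₗ[ℝ] V) : V ≃ᵃ[ℝ] V := w.toAffineEquiv

/-- The extended affine Weyl group `W̃ = X ⋊ W`, realized as the set of affine
transformations of the form `t_ν ∘ w` with `ν ∈ X` and `w ∈ W`. -/
def extAff : Set (V ≃ᵃ[ℝ] V) :=
  {g | ∃ ν ∈ S.X, ∃ w ∈ S.Weyl, g = S.trans ν * S.ofW w}

/-- The base alcove `A₀`. -/
def A0 : Set V := {x | ∀ α ∈ S.Rpos, 0 < S.coroot α x ∧ S.coroot α x < 1}

/-- The affine hyperplane `⟨·,α∨⟩ = n` separates the base alcove `A₀` from its image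
`g(A₀)`. -/
def Separates (α : V) (n : ℤ) (g : V ≃ᵃ[ℝ] V) : Prop :=
  ((∀ x ∈ S.A0, S.coroot α x < (n : ℝ)) ∧ (∀ x ∈ S.A0, (n : ℝ) < S.coroot α (g x))) ∨
  ((∀ x ∈ S.A0, (n : ℝ) < S.coroot α x) ∧ (∀ x ∈ S.A0, S.coroot α (g x) < (n : ℝ)))

/-- The length `ℓ(g)` of an element of the extended affine Weyl group: the number of
affine root hyperplanes separating `A₀` from `g(A₀)`. -/
noncomputable def len (g : V ≃ᵃ[ℝ] V) : ℕ :=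
  Set.ncard {q : V × ℤ | q.1 ∈ S.Rpos ∧ S.Separates q.1 q.2 g}

/-- The set of affine reflections `s_{α,n} : x ↦ x - (⟨x,α∨⟩ - n)α`. -/
def affRefl : Set (V ≃ᵃ[ℝ] V) :=
  {g | ∃ α ∈ S.R, ∃ n : ℤ, ∀ x, g x = x - (S.coroot α x - (n : ℝ)) • α}

/-- The Bruhat order on the extended affine Weyl group, generated by
`u < r·u` for affine reflections `r` with `ℓ(u) < ℓ(r·u)` (this fixes the
`Ω`-component, so it is the componentwise extension of the Bruhat order on `W_a`). -/
def bruhatLE : (V ≃ᵃ[ℝ] V) → (V ≃ᵃ[ℝ] V) → Prop :=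
  Relation.ReflTransGen fun u w => (∃ r ∈ S.affRefl, w = r * u) ∧ S.len u < S.len w

/-- Jantzen's `↑`-order, transported to the (extended) affine Weyl group via
`w̃ ↦ w̃(A₀)`: generated by `u ↑ s_{α,n}·u` whenever `u(A₀)` lies below the hyperplane
`⟨·,α∨⟩ = n`.  (Under the affine rescaling `λ ↦ (λ+η)/p` this is equivalent to the usual
`↑`-order on `p`-alcoves, transported via the `p`-dot action `w̃ ↦ w̃ · C₀`.) -/
def upLE : (V ≃ᵃ[ℝ] V) → (V ≃ᵃ[ℝ] V) → Prop :=
  Relation.ReflTransGen fun u w =>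
    ∃ α ∈ S.Rpos, ∃ n : ℤ,
      (∀ x : V, w x = u x - (S.coroot α (u x) - (n : ℝ)) • α) ∧
      ∀ x ∈ S.A0, S.coroot α (u x) < (n : ℝ)

/-- `W̃⁺`: the elements of `W̃` taking the base alcove to a dominant alcove. -/
def Wplus : Set (V ≃ᵃ[ℝ] V) :=
  {g | g ∈ S.extAff ∧ ∀ x ∈ S.A0, ∀ α ∈ S.Δ, 0 < S.coroot α (g x)}

/-- `W̃₁`: the elements of `W̃` taking the base alcove to a restricted alcove. -/
def Wone : Set (V ≃ᵃ[ℝ] V) :=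
  {g | g ∈ S.extAff ∧ ∀ x ∈ S.A0, ∀ α ∈ S.Δ,
    0 < S.coroot α (g x) ∧ S.coroot α (g x) < 1}

/-- `w̃_h = w₀ t_{-η}`. -/
noncomputable def wh : V ≃ᵃ[ℝ] V := S.ofW S.w0 * S.trans (-S.eta)

/-- The lowest `p`-alcove `C₀`. -/
def C0 (p : ℕ) : Set V :=
  {x | ∀ α ∈ S.Rpos, 0 < S.coroot α (x + S.eta) ∧ S.coroot α (x + S.eta) < (p : ℝ)}

/-- The root lattice `ℤR`. -/
def rootLattice : AddSubgroup V := AddSubgroup.closure (S.R : Set V)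

/-- `Ω`: the stabilizer of the base alcove in `W̃`. -/
def Omega : Set (V ≃ᵃ[ℝ] V) := {g | g ∈ S.extAff ∧ g '' S.A0 = S.A0}

/-- The `λ`-admissible set `Adm(λ) = ⋃_{w ∈ W} W̃_{≤ t_{w(λ)}}`. -/
def Adm (lam : V) : Set (V ≃ᵃ[ℝ] V) :=
  {g | ∃ w ∈ S.Weyl, S.bruhatLE g (S.trans (w lam))}

/-- `α∨` is a highest coroot, i.e. the highest root of an irreducible component of the
dual root system `R∨`: equivalently, `α∨` is a dominant coroot and no simple coroot can
be added to `α∨` to yield a coroot. -/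
def IsHighestCoroot (α : V) : Prop :=
  α ∈ S.R ∧ (∀ β ∈ S.Δ, 0 ≤ S.coroot α β) ∧
    ∀ β ∈ S.Δ, ∀ γ ∈ S.R, S.coroot γ ≠ S.coroot α + S.coroot β

end Ctx


namespace Ctx

variable {V} (S : Ctx V)

/-- The canonical Weyl-invariant symmetric form `∑_δ ⟨x, δ∨⟩ ⟨y, δ∨⟩`. -/
noncomputable def form (x y : V) : ℝ := ∑ δ ∈ S.R, S.coroot δ x * S.coroot δ y

lemma form_comm (x y : V) : S.form x y = S.form y x := by
  simp [form, mul_comm]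

lemma form_add_right (x y z : V) : S.form x (y + z) = S.form x y + S.form x z := by
  simp [form, mul_add, Finset.sum_add_distrib]

lemma form_smul_right (c : ℝ) (x y : V) : S.form x (c • y) = c * S.form x y := by
  simp only [form, map_smul, smul_eq_mul, Finset.mul_sum]
  exact Finset.sum_congr rfl fun _ _ => by ring

lemma form_sub_right (x y z : V) : S.form x (y - z) = S.form x y - S.form x z := by
  simp [form, mul_sub, Finset.sum_sub_distrib]

lemma form_sum_right {ι : Type*} (s : Finset ι) (x : V) (f : ι → V) :
    S.form x (∑ i ∈ s, f i) = ∑ i ∈ s, S.form x (f i) := by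
  simp only [form, map_sum, Finset.mul_sum]
  exact Finset.sum_comm

lemma reflect_reflect {α : V} (hα : α ∈ S.R) (x : V) :
    (x - S.coroot α x • α) - S.coroot α (x - S.coroot α x • α) • α = x := by
  simp only [map_sub, map_smul, S.coroot_self α hα, smul_eq_mul]
  module

lemma form_reflect {α : V} (hα : α ∈ S.R) (x y : V) :
    S.form (x - S.coroot α x • α) (y - S.coroot α y • α) = S.form x y := by
  refine Finset.sum_bij' (fun δ _ => δ - S.coroot α δ • α) (fun δ _ => δ - S.coroot α δ • α)
    (fun δ hδ => S.reflect_root α hα δ hδ) (fun δ hδ => S.reflect_root α hα δ hδ)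
    (fun δ _ => S.reflect_reflect hα δ) (fun δ _ => S.reflect_reflect hα δ) fun δ hδ => ?_
  simp only [S.reflect_coroot α hα δ hδ, map_sub, map_smul, smul_eq_mul]
  ring

lemma form_self_pos {α : V} (hα : α ∈ S.R) : 0 < S.form α α := by
  refine Finset.sum_pos' (fun δ _ => mul_self_nonneg _) ⟨α, hα, ?_⟩
  rw [S.coroot_self α hα]
  norm_num

lemma coroot_mul_form_self {α : V} (hα : α ∈ S.R) (x : V) :
    S.coroot α x * S.form α α = 2 * S.form x α := by
  have h := S.form_reflect hα α (x - S.coroot α x • α)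
  rw [S.reflect_reflect hα, S.coroot_self α hα] at h
  have h' : α - (2 : ℝ) • α = (-1 : ℝ) • α := by module
  rw [h', S.form_comm, form_smul_right, form_sub_right, form_smul_right, S.form_comm α x] at h
  linarith

lemma coroot_nonneg_iff {α : V} (hα : α ∈ S.R) (x : V) :
    0 ≤ S.coroot α x ↔ 0 ≤ S.form x α := by
  have h := S.coroot_mul_form_self hα x
  rw [← mul_nonneg_iff_of_pos_right (S.form_self_pos hα), h]
  constructor <;> intro <;> linarith

lemma coroot_symm_nonneg {α β : V} (hα : α ∈ S.R) (hβ : β ∈ S.R) (h : 0 ≤ S.coroot α β) :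
    0 ≤ S.coroot β α := by
  rw [S.coroot_nonneg_iff hβ, S.form_comm]
  exact (S.coroot_nonneg_iff hα β).1 h

lemma simple_mem {β : V} (hβ : β ∈ S.Δ) : β ∈ S.R := S.pos_subset (S.simple_subset hβ)

/-- A dominant vector pairs nonnegatively with every positive coroot. -/
lemma coroot_nonneg_of_dominant {x : V} (hx : ∀ β ∈ S.Δ, 0 ≤ S.coroot β x) {γ : V}
    (hγ : γ ∈ S.Rpos) : 0 ≤ S.coroot γ x := by
  rw [S.coroot_nonneg_iff (S.pos_subset hγ)]
  obtain ⟨c, hc⟩ := S.pos_sum_simple γ hγ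
  rw [hc, form_sum_right]
  refine Finset.sum_nonneg fun β hβ => ?_
  rw [form_smul_right]
  exact mul_nonneg (Nat.cast_nonneg _) ((S.coroot_nonneg_iff (S.simple_mem hβ) x).1 (hx β hβ))

lemma form_sq_le (x y : V) : S.form x y ^ 2 ≤ S.form x x * S.form y y := by
  simpa only [form, sq] using Finset.sum_mul_sq_le_sq_mul_sq S.R (S.coroot · x) (S.coroot · y)

lemma mapsTo_reflection {α : V} (hα : α ∈ S.R) :
    Set.MapsTo (Module.preReflection α (S.coroot α)) (S.R : Set V) S.R := fun β hβ =>
  S.reflect_root α hα β hβ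

/-- Two roots at an obtuse angle are opposite or add up to a root. -/
lemma add_eq_zero_or_mem {α β : V} (hα : α ∈ S.R) (hβ : β ∈ S.R) (h : S.form α β < 0) :
    α + β = 0 ∨ α + β ∈ S.R := by
  obtain ⟨p, hp⟩ := S.crystallographic β hβ α hα
  obtain ⟨q, hq⟩ := S.crystallographic α hα β hβ
  have hpf := S.coroot_mul_form_self hβ α
  have hqf := S.coroot_mul_form_self hα β
  rw [S.form_comm β α] at hqf
  have hα0 := S.form_self_pos hα
  have hβ0 := S.form_self_pos hβ
  by_cases hp1 : p = -1
  · right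
    have := S.reflect_root β hβ α hα
    simpa [hp, hp1] using this
  by_cases hq1 : q = -1
  · right
    have := S.reflect_root α hα β hβ
    simpa [hq, hq1, add_comm] using this
  left
  rw [hp] at hpf
  rw [hq] at hqf
  have hp0 : (p : ℝ) < 0 := by by_contra! h0; nlinarith
  have hq0 : (q : ℝ) < 0 := by by_contra! h0; nlinarith
  have hp2 : (p : ℝ) ≤ -2 := by
    have : p < 0 := by exact_mod_cast hp0
    exact_mod_cast (by omega : p ≤ -2)
  have hq2 : (q : ℝ) ≤ -2 := by
    have : q < 0 := by exact_mod_cast hq0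
    exact_mod_cast (by omega : q ≤ -2)
  have hcs := S.form_sq_le α β
  generalize S.form α β = b at *
  generalize S.form α α = a at *
  generalize S.form β β = c at *
  have h1 : b ≤ -c := by nlinarith
  have h2 : b ≤ -a := by nlinarith
  have h3 : a = -b := by nlinarith
  have h4 : c = -b := by nlinarith
  have hp' : S.coroot β α = -2 := by
    rw [hp]; rw [h4] at hpf; apply mul_right_cancel₀ h.ne; linarith
  have hq' : S.coroot α β = -2 := by
    rw [hq]; rw [h3] at hqf; apply mul_right_cancel₀ h.ne; linarith
  have hβn := S.neg_mem β hβ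
  have : IsAddTorsionFree V := .of_isTorsionFree ℝ V
  have key : α = -β := Module.eq_of_mapsTo_reflection_of_mem (R := ℝ) (Φ := (S.R : Set V))
    S.R.finite_toSet
    (f := S.coroot α) (g := S.coroot (-β)) (S.coroot_self α hα) (S.coroot_self _ hβn)
    (by simp [S.coroot_neg β hβ, hp']) (by simp [hq'])
    (S.mapsTo_reflection hα) (S.mapsTo_reflection hβn) hβn
  rw [key, neg_add_cancel]

lemma exists_multiset_of_mem_rootLattice {x : V} (hx : x ∈ S.rootLattice) :
    ∃ m : Multiset V, (∀ α ∈ m, α ∈ S.R) ∧ m.sum = x := by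
  induction hx using AddSubgroup.closure_induction with
  | mem x hx => exact ⟨{x}, by simpa using hx, by simp⟩
  | zero => exact ⟨0, by simp, by simp⟩
  | add x y _ _ hx hy =>
    obtain ⟨m, hm, rfl⟩ := hx
    obtain ⟨n, hn, rfl⟩ := hy
    refine ⟨m + n, fun α hα => ?_, by simp⟩
    exact (Multiset.mem_add.1 hα).elim (hm α) (hn α)
  | neg x _ hx =>
    obtain ⟨m, hm, rfl⟩ := hx
    refine ⟨m.map Neg.neg, fun α hα => ?_, Multiset.sum_map_neg' m⟩
    obtain ⟨β, hβ, rfl⟩ := Multiset.mem_map.1 hα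
    exact S.neg_mem β (hm β hβ)

lemma form_multiset_sum_nonneg {x : V} {m : Multiset V} (h : ∀ y ∈ m, 0 ≤ S.form x y) :
    0 ≤ S.form x m.sum := by
  induction m using Multiset.induction_on with
  | empty => simp [form]
  | cons a m ih =>
    rw [Multiset.sum_cons, form_add_right]
    exact add_nonneg (h a (by simp)) (ih fun y hy => h y (by simp [hy]))

/-- An element of the root lattice that pairs to at most `1` with every coroot vanishes. -/
lemma eq_zero_of_coroot_le_one {κ : V} (hκ : κ ∈ S.rootLattice)
    (h : ∀ α ∈ S.R, S.coroot α κ ≤ 1) : κ = 0 := by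
  have hex : ∃ n, ∃ m : Multiset V, (∀ α ∈ m, α ∈ S.R) ∧ m.sum = κ ∧ m.card = n := by
    obtain ⟨m, hm, hs⟩ := S.exists_multiset_of_mem_rootLattice hκ
    exact ⟨_, m, hm, hs, rfl⟩
  obtain ⟨m, hm, hs, hc⟩ := Nat.find_spec hex
  have hmin : ∀ m' : Multiset V, (∀ α ∈ m', α ∈ S.R) → m'.sum = κ → m.card ≤ m'.card :=
    fun m' h1 h2 => hc ▸ Nat.find_min' hex ⟨m', h1, h2, rfl⟩
  rcases m.empty_or_exists_mem with rfl | ⟨a, ha⟩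
  · simpa using hs.symm
  exfalso
  obtain ⟨m₁, rfl⟩ := Multiset.exists_cons_of_mem ha
  have haR : a ∈ S.R := hm a ha
  have hnn : 0 ≤ S.form a m₁.sum := by
    refine S.form_multiset_sum_nonneg fun b hb => ?_
    by_contra! hlt
    obtain ⟨m₂, rfl⟩ := Multiset.exists_cons_of_mem hb
    simp only [Multiset.mem_cons, forall_eq_or_imp, Multiset.sum_cons, Multiset.card_cons]
      at hm hs hmin
    rcases S.add_eq_zero_or_mem haR hm.2.1 hlt with h0 | h0
    · have := hmin m₂ hm.2.2 (by rw [← hs, ← add_assoc, h0, zero_add])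
      omega
    · have := hmin ((a + b) ::ₘ m₂) (by simpa using ⟨h0, hm.2.2⟩) (by simp [← hs, add_assoc])
      rw [Multiset.card_cons] at this
      omega
  have h1 := S.coroot_mul_form_self haR κ
  have h2 := S.form_self_pos haR
  have h3 : S.form κ a = S.form a a + S.form a m₁.sum := by
    rw [← hs, S.form_comm, Multiset.sum_cons, form_add_right]
  nlinarith [h a haR]

lemma rootLattice_le : S.rootLattice ≤ S.X :=
  (AddSubgroup.closure_le _).2 fun α hα => S.root_mem_X α hα

lemma dominant_of_isHighestCoroot {α : V} (h : S.IsHighestCoroot α) {γ : V} (hγ : γ ∈ S.Rpos) :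
    0 ≤ S.coroot γ α :=
  S.coroot_nonneg_of_dominant
    (fun β hβ => S.coroot_symm_nonneg h.1 (S.simple_mem hβ) (h.2.1 β hβ)) hγ

/-- Subtracting a root at which the pairing with the coroot is `2` preserves dominance. -/
lemma dominant_sub {κ α : V} (hκ : κ ∈ S.rootLattice)
    (hle : ∀ α ∈ S.R, S.coroot α κ ≤ 2)
    (hhc : ∀ α ∈ S.R, S.coroot α κ = 2 → S.IsHighestCoroot α)
    (hdom : ∀ α ∈ S.Δ, 0 ≤ S.coroot α κ) (hα : α ∈ S.R) (h2 : S.coroot α κ = 2)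
    {β : V} (hβ : β ∈ S.Δ) : 0 ≤ S.coroot β (κ - α) := by
  have hβR := S.simple_mem hβ
  obtain ⟨p, hp⟩ := S.crystallographic β hβR α hα
  obtain ⟨k, hk⟩ := S.coroot_int β hβR κ (S.rootLattice_le hκ)
  have hk0 := hdom β hβ
  have hpk : 2 * p ≤ k + 2 := by
    have hr := S.reflect_root α hα β hβR
    have h := hle _ (S.neg_mem _ hr)
    rw [S.coroot_neg _ hr, LinearMap.neg_apply, S.reflect_coroot α hα β hβR, h2, hp, hk] at h
    have h' : (2 * p : ℝ) ≤ k + 2 := by linarith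
    exact_mod_cast h'
  have hp0 : k = 0 → p ≤ 0 := by
    rintro rfl
    have hr := S.reflect_root β hβR α hα
    have h : S.coroot (α - S.coroot β α • β) κ = 2 := by
      rw [S.reflect_coroot β hβR α hα, hk, h2]
      simp
    have h' := (hhc _ hr h).2.1 β hβ
    rw [S.reflect_coroot β hβR α hα, S.coroot_self β hβR] at h'
    have h'' : 0 ≤ S.coroot α (-β) := by
      rw [map_neg]
      linarith
    have h3 := S.coroot_symm_nonneg hα (S.neg_mem β hβR) h''
    rw [S.coroot_neg β hβR, LinearMap.neg_apply, hp] at h3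
    have h4 : (p : ℝ) ≤ 0 := by linarith
    exact_mod_cast h4
  rw [map_sub, hp, hk, sub_nonneg]
  rw [hk] at hk0
  have hk0' : 0 ≤ k := by exact_mod_cast hk0
  have : p ≤ k := by
    by_cases hk1 : k = 0
    · exact hk1 ▸ hp0 hk1
    · omega
  exact_mod_cast this

lemma coroot_sub_le {κ α : V} (hdom : ∀ β ∈ S.Δ, 0 ≤ S.coroot β (κ - α))
    (hα : S.IsHighestCoroot α) {γ : V} (hγ : γ ∈ S.R) :
    S.coroot γ (κ - α) ≤ max 0 (S.coroot γ κ) := by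
  rcases S.pos_or_neg γ hγ with h | h
  · have := S.dominant_of_isHighestCoroot hα h
    rw [map_sub]
    exact le_max_of_le_right (by linarith)
  · have := S.coroot_nonneg_of_dominant hdom h
    rw [S.coroot_neg γ hγ, LinearMap.neg_apply] at this
    exact le_max_of_le_left (by linarith)

/-- The summands can be taken among the roots whose coroots pair to `2` with `κ`. -/
lemma exists_sum_eq {κ : V} (hκ : κ ∈ S.rootLattice)
    (hle : ∀ α ∈ S.R, S.coroot α κ ≤ 2)
    (hhc : ∀ α ∈ S.R, S.coroot α κ = 2 → S.IsHighestCoroot α)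
    (hdom : ∀ α ∈ S.Δ, 0 ≤ S.coroot α κ) :
    ∃ T ⊆ S.R.filter fun α => S.coroot α κ = 2, κ = ∑ α ∈ T, α := by
  induction hn : (S.R.filter fun α => S.coroot α κ = 2).card using Nat.strong_induction_on
    generalizing κ with
  | _ n ih =>
  by_cases hex : ∃ α ∈ S.R, S.coroot α κ = 2
  · obtain ⟨α, hα, h2⟩ := hex
    have hhα := hhc α hα h2
    have hdom' : ∀ β ∈ S.Δ, 0 ≤ S.coroot β (κ - α) := fun β hβ =>
      S.dominant_sub hκ hle hhc hdom hα h2 hβ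
    have hle' : ∀ γ ∈ S.R, S.coroot γ (κ - α) ≤ 2 := fun γ hγ =>
      (S.coroot_sub_le hdom' hhα hγ).trans (max_le (by norm_num) (hle γ hγ))
    have heq : ∀ γ ∈ S.R, S.coroot γ (κ - α) = 2 → S.coroot γ κ = 2 := by
      intro γ hγ h
      have h' := S.coroot_sub_le hdom' hhα hγ
      rw [h] at h'
      rcases le_max_iff.1 h' with h0 | h0
      · norm_num at h0
      · exact le_antisymm (hle γ hγ) h0
    have hα0 : S.coroot α (κ - α) = 0 := by rw [map_sub, h2, S.coroot_self α hα, sub_self]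
    have hsub : (S.R.filter fun γ => S.coroot γ (κ - α) = 2) ⊆
        S.R.filter fun γ => S.coroot γ κ = 2 := fun γ hγ => by
      rw [Finset.mem_filter] at hγ ⊢
      exact ⟨hγ.1, heq γ hγ.1 hγ.2⟩
    have hnot : α ∉ S.R.filter fun γ => S.coroot γ (κ - α) = 2 := fun h => by
      have := (Finset.mem_filter.1 h).2
      linarith
    have hmem : α ∈ S.R.filter fun γ => S.coroot γ κ = 2 := by simp [hα, h2]
    obtain ⟨T, hT, hsum⟩ := ih _
      (hn ▸ Finset.card_lt_card (Finset.ssubset_iff_subset_ne.2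
        ⟨hsub, fun h => hnot (h ▸ hmem)⟩))
      (S.rootLattice.sub_mem hκ (AddSubgroup.subset_closure hα)) hle'
      (fun γ hγ h => hhc γ hγ (heq γ hγ h)) hdom' rfl
    refine ⟨insert α T, Finset.insert_subset hmem (hT.trans hsub), ?_⟩
    rw [Finset.sum_insert fun h => hnot (hT h), ← hsum, add_sub_cancel]
  · push Not at hex
    refine ⟨∅, Finset.empty_subset _, ?_⟩
    rw [Finset.sum_empty]
    refine S.eq_zero_of_coroot_le_one hκ fun α hα => ?_
    obtain ⟨k, hk⟩ := S.coroot_int α hα κ (S.rootLattice_le hκ)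
    have h1 := (hle α hα).lt_of_ne (hex α hα)
    rw [hk] at h1 ⊢
    have h2 : k < 2 := by exact_mod_cast h1
    exact_mod_cast (by omega : k ≤ 1)

end Ctx

/-- Claim `highestcoroot`: a dominant element of the root lattice pairing
to at most `2` with every coroot, with equality only at highest coroots, is a
multiplicity-free sum of roots whose corresponding coroots are highest coroots. -/
theorem statement13 {V : Type} [AddCommGroup V] [Module ℝ V] [FiniteDimensional ℝ V]
    (S : Ctx V) (κ : V) (hκ : κ ∈ S.rootLattice)
    (hle : ∀ α ∈ S.R, S.coroot α κ ≤ 2)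
    (hhc : ∀ α ∈ S.R, S.coroot α κ = 2 → S.IsHighestCoroot α)
    (hdom : ∀ α ∈ S.Δ, 0 ≤ S.coroot α κ) :
    ∃ T : Finset V, (∀ α ∈ T, α ∈ S.R) ∧ (∀ α ∈ T, S.IsHighestCoroot α) ∧
      κ = ∑ α ∈ T, α := by
  obtain ⟨T, hT, hsum⟩ := S.exists_sum_eq hκ hle hhc hdom
  have hT' : ∀ α ∈ T, α ∈ S.R ∧ S.coroot α κ = 2 := fun α hα => Finset.mem_filter.1 (hT hα)
  exact ⟨T, fun α hα => (hT' α hα).1, fun α hα => hhc α (hT' α hα).1 (hT' α hα).2, hsum⟩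

end SerrePaper
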